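/- arXiv:1911.08362 — 2 statements merged into one kernel-verified Lean document; each statement's English description precedes it below -/
import Mathlib

section
/- For every action a and every function V̂ : S → ℝ, the N-step δHCA advantage estimator has the same conditional expectation as the N-step Monte-Carlo advantage estimator: E_π[Â^δHCA_N(a) | S_0 = s] = E_π[Â^MC_N(a) | S_0 = s]. -/
open Finset

attribute [local instance] Classical.propDecidable

namespace HCA

/-- A trajectory of horizon `N`: the actions taken at steps `0, …, N-1` and the
states reached after each step (the start state is fixed separately). -/
abbrev Traj (S A : Type*) (N : ℕ) : Type _ := (Fin N → A) × (Fin N → S)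

variable {S A : Type*} [Fintype S] [Fintype A] [Nonempty S] [Nonempty A]

/-- The state `S_k` of a trajectory with start state `s`. -/
def st {N : ℕ} (s : S) (τ : Traj S A N) : ℕ → S
  | 0 => s
  | k + 1 => if h : k < N then τ.2 ⟨k, h⟩ else s

/-- The action `A_k` of a trajectory. -/
noncomputable def ac {N : ℕ} (τ : Traj S A N) (k : ℕ) : A :=
  if h : k < N then τ.1 ⟨k, h⟩ else Classical.arbitrary A

/-- The probability `P_π(τ) = ∏_{k=0}^{N-1} π(A_k|S_k)·P(S_{k+1}|S_k,A_k)` of a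
trajectory starting at `s`. -/
noncomputable def trajP (π : S → A → ℝ) (P : S → A → S → ℝ) (s : S) (N : ℕ)
    (τ : Traj S A N) : ℝ :=
  ∏ k : Fin N, π (st s τ k) (τ.1 k) * P (st s τ k) (τ.1 k) (st s τ (k + 1))

/-- Expectation `E_π[f | S_0 = s]` over trajectories. -/
noncomputable def expct (π : S → A → ℝ) (P : S → A → S → ℝ) (s : S) (N : ℕ)
    (f : Traj S A N → ℝ) : ℝ :=
  ∑ τ : Traj S A N, trajP π P s N τ * f τ

/-- Variance `Var_π(f | S_0 = s)` over trajectories. -/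
noncomputable def vr (π : S → A → ℝ) (P : S → A → S → ℝ) (s : S) (N : ℕ)
    (f : Traj S A N → ℝ) : ℝ :=
  expct π P s N (fun τ => (f τ - expct π P s N f) ^ 2)

/-- Covariance `cov_π(f, g | S_0 = s)` over trajectories. -/
noncomputable def cv (π : S → A → ℝ) (P : S → A → S → ℝ) (s : S) (N : ℕ)
    (f g : Traj S A N → ℝ) : ℝ :=
  expct π P s N (fun τ => (f τ - expct π P s N f) * (g τ - expct π P s N g))

/-- Probability `P_π(E | S_0 = s)` of an event `E` on trajectories. -/
noncomputable def prE (π : S → A → ℝ) (P : S → A → S → ℝ) (s : S) (N : ℕ)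
    (E : Traj S A N → Prop) : ℝ :=
  ∑ τ : Traj S A N, if E τ then trajP π P s N τ else 0

/-- The TD error `δ_k = r(S_k,A_k) + γ·V̂(S_{k+1}) − V̂(S_k)`. -/
noncomputable def td (r : S → A → ℝ) (γ : ℝ) (V : S → ℝ) (s : S) {N : ℕ}
    (τ : Traj S A N) (k : ℕ) : ℝ :=
  r (st s τ k) (ac τ k) + γ * V (st s τ (k + 1)) - V (st s τ k)

/-- `p_k(s'|s,a) = P_π(S_k = s' | S_0 = s, A_0 = a)
  = P_π(A_0 = a, S_k = s' | S_0 = s) / π(a|s)`. -/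
noncomputable def pkSA (π : S → A → ℝ) (P : S → A → S → ℝ) (s : S) (N k : ℕ)
    (a : A) (s' : S) : ℝ :=
  prE π P s N (fun τ => ac τ 0 = a ∧ st s τ k = s') / π s a

/-- `p_k(s'|s) = Σ_a π(a|s)·p_k(s'|s,a)`. -/
noncomputable def pkS (π : S → A → ℝ) (P : S → A → S → ℝ) (s : S) (N k : ℕ)
    (s' : S) : ℝ :=
  ∑ a : A, π s a * pkSA π P s N k a s'

/-- The hindsight probability `p_k(a|s,s')`, defined as
`P_π(A_0 = a, S_k = s' | S_0 = s)/p_k(s'|s)` when `p_k(s'|s) > 0` and `0` otherwise. -/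
noncomputable def pkA (π : S → A → ℝ) (P : S → A → S → ℝ) (s : S) (N k : ℕ)
    (a : A) (s' : S) : ℝ :=
  if 0 < pkS π P s N k s' then
    prE π P s N (fun τ => ac τ 0 = a ∧ st s τ k = s') / pkS π P s N k s'
  else 0

/-- The `N`-step Monte-Carlo advantage estimator
`Â^MC_N(a) = (1(A_0=a)/π(a|s))·Σ_{k=0}^{N−1} γ^k·δ_k`. -/
noncomputable def mcEst (π : S → A → ℝ) (r : S → A → ℝ) (γ : ℝ) (V : S → ℝ)
    (s : S) (N : ℕ) (a : A) (τ : Traj S A N) : ℝ :=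
  ((if ac τ 0 = a then (1 : ℝ) else 0) / π s a) * ∑ k ∈ range N, γ ^ k * td r γ V s τ k

/-- The `N`-step δHCA advantage estimator
`Â^δHCA_N(a) = (1(A_0=a)/π(a|s))·δ_0 + Σ_{k=1}^{N−1} γ^k·(p_k(a|s,S_k)/π(a|s))·δ_k`. -/
noncomputable def dhcaEst (π : S → A → ℝ) (P : S → A → S → ℝ) (r : S → A → ℝ)
    (γ : ℝ) (V : S → ℝ) (s : S) (N : ℕ) (a : A) (τ : Traj S A N) : ℝ :=
  ((if ac τ 0 = a then (1 : ℝ) else 0) / π s a) * td r γ V s τ 0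
    + ∑ k ∈ Ico 1 N, γ ^ k * (pkA π P s N k a (st s τ k) / π s a) * td r γ V s τ k

/-- `V` satisfies the Bellman equation for `π`:
`V(s₀) = Σ_a π(a|s₀)·(r(s₀,a) + γ·Σ_{s'} P(s'|s₀,a)·V(s'))` for every state `s₀`. -/
def IsBellman (π : S → A → ℝ) (P : S → A → S → ℝ) (r : S → A → ℝ) (γ : ℝ)
    (V : S → ℝ) : Prop :=
  ∀ s₀ : S, V s₀ = ∑ a : A, π s₀ a * (r s₀ a + γ * ∑ s' : S, P s₀ a s' * V s')

/-- The conditional second moment `E_π[δ_k² | S_0 = s, S_k = s']`,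
defined as `(Σ_{τ : S_k = s'} P_π(τ)·δ_k(τ)²)/p_k(s'|s)`. -/
noncomputable def sndMom (π : S → A → ℝ) (P : S → A → S → ℝ) (r : S → A → ℝ)
    (γ : ℝ) (V : S → ℝ) (s : S) (N k : ℕ) (s' : S) : ℝ :=
  (∑ τ : Traj S A N, if st s τ k = s' then trajP π P s N τ * (td r γ V s τ k) ^ 2 else 0)
    / pkS π P s N k s'

/-- Extend a trajectory by one step. -/
def ext1 {S A : Type*} {N : ℕ} (τ : Traj S A N) (b : A) (x : S) : Traj S A (N + 1) :=
  (Fin.snoc (α := fun _ => A) τ.1 b, Fin.snoc (α := fun _ => S) τ.2 x)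

theorem st_ext1 {S A : Type*} {N : ℕ} (s : S) (τ : Traj S A N) (b : A) (x : S) (k : ℕ)
    (hk : k ≤ N) : st s (ext1 τ b x) k = st s τ k := by
  cases k with
  | zero => rfl
  | succ j =>
    have h1 : j < N := hk
    have h2 : j < N + 1 := by omega
    simp [st, ext1, h1, h2, Fin.snoc]

theorem st_ext1_last {S A : Type*} {N : ℕ} (s : S) (τ : Traj S A N) (b : A) (x : S) :
    st s (ext1 τ b x) (N + 1) = x := by
  simp [st, ext1, Fin.snoc]

theorem ac_ext1 {S A : Type*} [Nonempty A] {N : ℕ} (τ : Traj S A N) (b : A) (x : S) (k : ℕ)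
    (hk : k < N) : ac (ext1 τ b x) k = ac τ k := by
  have h2 : k < N + 1 := by omega
  simp [ac, ext1, hk, h2, Fin.snoc]

theorem ac_ext1_last {S A : Type*} [Nonempty A] {N : ℕ} (τ : Traj S A N) (b : A) (x : S) :
    ac (ext1 τ b x) N = b := by
  simp [ac, ext1, Fin.snoc]

theorem trajP_ext1 {S A : Type*} (π : S → A → ℝ) (P : S → A → S → ℝ) (s : S) (N : ℕ)
    (τ : Traj S A N) (b : A) (x : S) :
    trajP π P s (N + 1) (ext1 τ b x)
      = trajP π P s N τ * (π (st s τ N) b * P (st s τ N) b x) := by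
  unfold trajP
  rw [Fin.prod_univ_castSucc]
  congr 1
  · apply Finset.prod_congr rfl
    intro k _
    have h1 : st s (ext1 τ b x) (k.castSucc : ℕ) = st s τ k := by
      simpa using st_ext1 s τ b x k k.2.le
    have h2 : st s (ext1 τ b x) ((k.castSucc : ℕ) + 1) = st s τ (k + 1) := by
      simpa using st_ext1 s τ b x (k + 1) k.2
    have h3 : (ext1 τ b x).1 k.castSucc = τ.1 k := by simp [ext1]
    rw [h1, h2, h3]
  · have h1 : st s (ext1 τ b x) ((Fin.last N : Fin (N + 1)) : ℕ) = st s τ N := by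
      simpa using st_ext1 s τ b x N le_rfl
    have h2 : st s (ext1 τ b x) (((Fin.last N : Fin (N + 1)) : ℕ) + 1) = x := by
      simpa using st_ext1_last s τ b x
    have h3 : (ext1 τ b x).1 (Fin.last N) = b := by simp [ext1]
    rw [h1, h2, h3]

theorem ext1_bij (S A : Type*) (N : ℕ) :
    Function.Bijective (fun q : Traj S A N × (A × S) => ext1 q.1 q.2.1 q.2.2) := by
  constructor
  · rintro ⟨⟨t1, t2⟩, b, x⟩ ⟨⟨u1, u2⟩, c, y⟩ h
    simp only [ext1, Prod.mk.injEq] at h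
    obtain ⟨h1, h2⟩ := h
    have e1 := congrArg Fin.init h1
    have e2 := congrArg Fin.init h2
    have e3 := congrFun h1 (Fin.last N)
    have e4 := congrFun h2 (Fin.last N)
    simp only [Fin.init_snoc, Fin.snoc_last] at e1 e2 e3 e4
    subst e1 e2 e3 e4
    rfl
  · rintro ⟨t, u⟩
    refine ⟨((Fin.init t, Fin.init u), (t (Fin.last N), u (Fin.last N))), ?_⟩
    simp [ext1]

theorem expct_succ {S A : Type*} [Fintype S] [Fintype A]
    (π : S → A → ℝ) (P : S → A → S → ℝ) (s : S) (N : ℕ) (f : Traj S A (N + 1) → ℝ) :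
    expct π P s (N + 1) f = expct π P s N (fun τ =>
      ∑ b : A, ∑ x : S, π (st s τ N) b * P (st s τ N) b x * f (ext1 τ b x)) := by
  unfold expct
  rw [← (ext1_bij S A N).sum_comp, Fintype.sum_prod_type]
  refine Finset.sum_congr rfl fun τ _ => ?_
  rw [Fintype.sum_prod_type, Finset.mul_sum]
  refine Finset.sum_congr rfl fun b _ => ?_
  rw [Finset.mul_sum]
  refine Finset.sum_congr rfl fun x _ => ?_
  rw [trajP_ext1]
  ring

theorem expct_succ_const {S A : Type*} [Fintype S] [Fintype A]
    (π : S → A → ℝ) (P : S → A → S → ℝ) (s : S) (N : ℕ)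
    (hπsum : ∀ s₀ : S, ∑ a : A, π s₀ a = 1)
    (hPsum : ∀ (s₀ : S) (a : A), ∑ s' : S, P s₀ a s' = 1)
    (f : Traj S A (N + 1) → ℝ) (g : Traj S A N → ℝ) (h : ∀ τ b x, f (ext1 τ b x) = g τ) :
    expct π P s (N + 1) f = expct π P s N g := by
  rw [expct_succ]
  congr 1
  funext τ
  simp only [h, ← Finset.sum_mul, ← Finset.mul_sum, hPsum, hπsum, mul_one, one_mul]

theorem markov {S A : Type*} [Fintype S] [Fintype A] [Nonempty A]
    (π : S → A → ℝ) (P : S → A → S → ℝ) (s : S)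
    (hπsum : ∀ s₀ : S, ∑ a : A, π s₀ a = 1)
    (hPsum : ∀ (s₀ : S) (a : A), ∑ s' : S, P s₀ a s' = 1)
    (w : A → S → ℝ) (h : S → A → S → ℝ) (k : ℕ) (hk : 1 ≤ k) (m : ℕ) :
    expct π P s (k + 1 + m)
      (fun τ => w (ac τ 0) (st s τ k) * h (st s τ k) (ac τ k) (st s τ (k + 1)))
    = expct π P s (k + 1 + m) (fun τ => w (ac τ 0) (st s τ k) *
        ∑ b : A, ∑ x : S, π (st s τ k) b * P (st s τ k) b x * h (st s τ k) b x) := by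
  induction m with
  | zero =>
    have e : expct π P s (k + 1) (fun τ => w (ac τ 0) (st s τ k) *
        ∑ b : A, ∑ x : S, π (st s τ k) b * P (st s τ k) b x * h (st s τ k) b x)
      = expct π P s k (fun τ => w (ac τ 0) (st s τ k) *
        ∑ b : A, ∑ x : S, π (st s τ k) b * P (st s τ k) b x * h (st s τ k) b x) := by
      apply expct_succ_const π P s k hπsum hPsum
      intro τ b x
      rw [st_ext1 s τ b x k le_rfl, ac_ext1 τ b x 0 (by omega)]
    rw [Nat.add_zero, e, expct_succ]
    congr 1
    funext τ
    rw [Finset.mul_sum]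
    refine Finset.sum_congr rfl fun b _ => ?_
    rw [Finset.mul_sum]
    refine Finset.sum_congr rfl fun x _ => ?_
    rw [st_ext1 s τ b x k le_rfl, ac_ext1 τ b x 0 (by omega), st_ext1_last, ac_ext1_last]
    ring
  | succ m ih =>
    rw [← Nat.add_assoc]
    refine (expct_succ_const π P s _ hπsum hPsum _ _ ?_).trans
      (ih.trans (expct_succ_const π P s _ hπsum hPsum _ _ ?_).symm)
    · intro τ b x
      rw [st_ext1 s τ b x k (by omega), ac_ext1 τ b x 0 (by omega),
        st_ext1 s τ b x (k + 1) (by omega), ac_ext1 τ b x k (by omega)]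
    · intro τ b x
      rw [st_ext1 s τ b x k (by omega), ac_ext1 τ b x 0 (by omega)]

theorem expct_group {S A : Type*} [Fintype S] [Fintype A] [Nonempty A]
    (π : S → A → ℝ) (P : S → A → S → ℝ) (s : S) (N k : ℕ) (f : A → S → ℝ) :
    expct π P s N (fun τ => f (ac τ 0) (st s τ k))
      = ∑ x : S, ∑ b : A, f b x * prE π P s N (fun τ => ac τ 0 = b ∧ st s τ k = x) := by
  unfold expct prE
  simp only [Finset.mul_sum]
  rw [Finset.sum_congr rfl (fun x _ => Finset.sum_comm)]
  rw [Finset.sum_comm]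
  refine Finset.sum_congr rfl fun τ _ => ?_
  rw [Finset.sum_eq_single (st s τ k), Finset.sum_eq_single (ac τ 0)]
  · simp [mul_comm]
  · intro b _ hb
    simp [Ne.symm hb]
  · simp
  · intro x _ hx
    simp [Ne.symm hx]
  · simp

theorem hca_swap {S A : Type*} [Fintype S] [Fintype A] [Nonempty A]
    (π : S → A → ℝ) (P : S → A → S → ℝ) (s : S) (N k : ℕ)
    (hπpos : ∀ s₀ a, 0 < π s₀ a) (hPnn : ∀ s₀ a s', 0 ≤ P s₀ a s') (a : A) (D : S → ℝ) :
    expct π P s N (fun τ => pkA π P s N k a (st s τ k) * D (st s τ k))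
      = expct π P s N (fun τ => (if ac τ 0 = a then (1 : ℝ) else 0) * D (st s τ k)) := by
  rw [expct_group π P s N k (fun _ x => pkA π P s N k a x * D x),
    expct_group π P s N k (fun b x => (if b = a then (1 : ℝ) else 0) * D x)]
  refine Finset.sum_congr rfl fun x _ => ?_
  have hS : pkS π P s N k x = ∑ b : A, prE π P s N (fun τ => ac τ 0 = b ∧ st s τ k = x) := by
    unfold pkS pkSA
    refine Finset.sum_congr rfl fun b _ => ?_
    rw [mul_div_cancel₀ _ (hπpos s b).ne']
  have hnn : ∀ b : A, 0 ≤ prE π P s N (fun τ => ac τ 0 = b ∧ st s τ k = x) := by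
    intro b
    refine Finset.sum_nonneg fun τ _ => ?_
    split_ifs
    · exact Finset.prod_nonneg fun i _ => mul_nonneg (hπpos _ _).le (hPnn _ _ _)
    · exact le_rfl
  rw [← Finset.mul_sum, ← hS, Finset.sum_eq_single a]
  · rw [if_pos rfl]
    unfold pkA
    split_ifs with h
    · field_simp
    · have h0 : prE π P s N (fun τ => ac τ 0 = a ∧ st s τ k = x) ≤ 0 := by
        refine le_trans ?_ (not_lt.mp h)
        rw [hS]
        exact Finset.single_le_sum
          (f := fun b => prE π P s N (fun τ => ac τ 0 = b ∧ st s τ k = x))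
          (fun b _ => hnn b) (Finset.mem_univ a)
      rw [le_antisymm h0 (hnn a)]
      simp
  · intro b _ hb
    simp [hb]
  · simp

theorem expct_add {S A : Type*} [Fintype S] [Fintype A]
    (π : S → A → ℝ) (P : S → A → S → ℝ) (s : S) (N : ℕ) (f g : Traj S A N → ℝ) :
    expct π P s N (fun τ => f τ + g τ) = expct π P s N f + expct π P s N g := by
  simp [expct, mul_add, Finset.sum_add_distrib]

theorem expct_sum {S A : Type*} [Fintype S] [Fintype A]
    (π : S → A → ℝ) (P : S → A → S → ℝ) (s : S) (N : ℕ) (I : Finset ℕ)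
    (f : ℕ → Traj S A N → ℝ) :
    expct π P s N (fun τ => ∑ k ∈ I, f k τ) = ∑ k ∈ I, expct π P s N (f k) := by
  simp only [expct, Finset.mul_sum]
  exact Finset.sum_comm

theorem expct_smul {S A : Type*} [Fintype S] [Fintype A]
    (π : S → A → ℝ) (P : S → A → S → ℝ) (s : S) (N : ℕ) (c : ℝ) (f : Traj S A N → ℝ) :
    expct π P s N (fun τ => c * f τ) = c * expct π P s N f := by
  simp only [expct, Finset.mul_sum]
  exact Finset.sum_congr rfl fun τ _ => by ring

theorem stmt_0 {S A : Type*} [Fintype S] [Fintype A] [Nonempty S] [Nonempty A]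
    (π : S → A → ℝ) (P : S → A → S → ℝ) (r : S → A → ℝ) (γ : ℝ)
    (N : ℕ) (s : S)
    (hπpos : ∀ s₀ a, 0 < π s₀ a) (hπsum : ∀ s₀ : S, ∑ a : A, π s₀ a = 1)
    (hPnn : ∀ s₀ a s', 0 ≤ P s₀ a s') (hPsum : ∀ (s₀ : S) (a : A), ∑ s' : S, P s₀ a s' = 1)
    (hγ0 : 0 ≤ γ) (hγ1 : γ ≤ 1) (hN : 1 ≤ N) :
    ∀ (a : A) (V : S → ℝ),
      expct π P s N (dhcaEst π P r γ V s N a) = expct π P s N (mcEst π r γ V s N a) := by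
  intro a V
  have hmc : mcEst π r γ V s N a = fun τ =>
      ((if ac τ 0 = a then (1 : ℝ) else 0) / π s a) * td r γ V s τ 0
      + ∑ k ∈ Ico 1 N, (γ ^ k / π s a) *
        ((if ac τ 0 = a then (1 : ℝ) else 0) * td r γ V s τ k) := by
    funext τ
    unfold mcEst
    rw [Finset.range_eq_Ico, Finset.sum_eq_sum_Ico_succ_bot (by omega), mul_add, Finset.mul_sum]
    congr 1
    · simp
    · exact Finset.sum_congr rfl fun k _ => by ring
  have hd : dhcaEst π P r γ V s N a = fun τ =>
      ((if ac τ 0 = a then (1 : ℝ) else 0) / π s a) * td r γ V s τ 0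
      + ∑ k ∈ Ico 1 N, (γ ^ k / π s a) *
        (pkA π P s N k a (st s τ k) * td r γ V s τ k) := by
    funext τ
    unfold dhcaEst
    congr 1
    exact Finset.sum_congr rfl fun k _ => by ring
  rw [hmc, hd, expct_add, expct_add, expct_sum, expct_sum]
  congr 1
  refine Finset.sum_congr rfl fun k hk => ?_
  rw [expct_smul, expct_smul]
  congr 1
  obtain ⟨hk1, hk2⟩ := Finset.mem_Ico.mp hk
  obtain ⟨m, hm⟩ := Nat.exists_eq_add_of_le (show k + 1 ≤ N from hk2)
  have key : ∀ w : A → S → ℝ, expct π P s N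
      (fun τ => w (ac τ 0) (st s τ k) * td r γ V s τ k)
      = expct π P s N (fun τ => w (ac τ 0) (st s τ k) *
        ∑ b : A, ∑ x : S, π (st s τ k) b * P (st s τ k) b x *
          (r (st s τ k) b + γ * V x - V (st s τ k))) := by
    intro w
    subst hm
    exact markov π P s hπsum hPsum w (fun y b x => r y b + γ * V x - V y) k hk1 m
  rw [key (fun _ x => pkA π P s N k a x), key (fun b _ => if b = a then (1 : ℝ) else 0)]
  exact hca_swap π P s N k hπpos hPnn a (fun y => ∑ b : A, ∑ x : S, π y b * P y b x *
          (r y b + γ * V x - V y))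

end HCA
end

section
/- (Markov hindsight identity) For every 1 ≤ k ≤ N−1, every action a, and all states s', s'' such that P_π(S_k = s', S_{k+1} = s'' | S_0 = s) > 0, the hindsight action probability is unchanged by additionally conditioning on the next state: P_π(A_0 = a | S_0 = s, S_k = s') = P_π(A_0 = a | S_0 = s, S_k = s', S_{k+1} = s''), where each conditional probability is the ratio of the P_π-probability of the joint event to that of the conditioning event. -/
open Finset

attribute [local instance] Classical.propDecidable

namespace HCA

variable {S A : Type*} [Fintype S] [Fintype A] [Nonempty S] [Nonempty A]

theorem st_snoc {S A : Type*} {N : ℕ} (s : S) (τ : Traj S A N) (b : A) (x : S) (k : ℕ)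
    (hk : k ≤ N) :
    st s ((Fin.snoc τ.1 b, Fin.snoc τ.2 x) : Traj S A (N+1)) k = st s τ k := by
  cases k with
  | zero => rfl
  | succ k =>
    have h1 : k < N := hk
    have h2 : k < N + 1 := by omega
    simp only [st, h1, h2, dif_pos]
    exact Fin.snoc_castSucc (α := fun _ => S) x τ.2 ⟨k, h1⟩

theorem st_snoc_last {S A : Type*} {N : ℕ} (s : S) (τ : Traj S A N) (b : A) (x : S) :
    st s ((Fin.snoc τ.1 b, Fin.snoc τ.2 x) : Traj S A (N+1)) (N+1) = x := by
  simp only [st, Nat.lt_succ_self, dif_pos]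
  exact Fin.snoc_last (α := fun _ => S) x τ.2

theorem ac_snoc {S A : Type*} [Nonempty A] {N : ℕ} (τ : Traj S A N) (b : A) (x : S) (k : ℕ)
    (hk : k < N) :
    ac ((Fin.snoc τ.1 b, Fin.snoc τ.2 x) : Traj S A (N+1)) k = ac τ k := by
  have h2 : k < N + 1 := by omega
  simp only [ac, hk, h2, dif_pos]
  exact Fin.snoc_castSucc (α := fun _ => A) b τ.1 ⟨k, hk⟩

theorem trajP_snoc {S A : Type*} (π : S → A → ℝ) (P : S → A → S → ℝ) (s : S)
    {N : ℕ} (τ : Traj S A N) (b : A) (x : S) :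
    trajP π P s (N+1) (Fin.snoc τ.1 b, Fin.snoc τ.2 x)
      = trajP π P s N τ * (π (st s τ N) b * P (st s τ N) b x) := by
  unfold trajP
  rw [Fin.prod_univ_castSucc]
  congr 1
  · refine Finset.prod_congr rfl fun i _ => ?_
    have hi := i.2
    simp only [Fin.val_castSucc, Fin.snoc_castSucc]
    rw [st_snoc s τ b x _ (by omega), st_snoc s τ b x _ (by omega)]
  · simp only [Fin.val_last, Fin.snoc_last]
    rw [st_snoc s τ b x _ le_rfl, st_snoc_last]

theorem sum_snoc {S A : Type*} [Fintype S] [Fintype A] {N : ℕ} (F : Traj S A (N+1) → ℝ) :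
    ∑ τ, F τ = ∑ τ : Traj S A N, ∑ b : A, ∑ x : S, F (Fin.snoc τ.1 b, Fin.snoc τ.2 x) := by
  let e : Traj S A N × A × S ≃ Traj S A (N+1) :=
    { toFun := fun p => (Fin.snoc p.1.1 p.2.1, Fin.snoc p.1.2 p.2.2)
      invFun := fun τ => ((Fin.init τ.1, Fin.init τ.2), τ.1 (Fin.last N), τ.2 (Fin.last N))
      left_inv := fun p => by simp
      right_inv := fun τ => by simp }
  rw [← e.sum_comp]
  simp only [Fintype.sum_prod_type (α₁ := Traj S A N), Fintype.sum_prod_type (α₁ := A)]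
  rfl

theorem expct_red {S A : Type*} [Fintype S] [Fintype A] [Nonempty A]
    (π : S → A → ℝ) (P : S → A → S → ℝ) (s : S)
    (hπsum : ∀ s₀ : S, ∑ a : A, π s₀ a = 1)
    (hPsum : ∀ (s₀ : S) (a : A), ∑ s' : S, P s₀ a s' = 1)
    (k : ℕ) (hk : 1 ≤ k) (f : A → S → S → ℝ) (N : ℕ) (hN : k + 1 ≤ N) :
    ∑ τ : Traj S A N, trajP π P s N τ * f (ac τ 0) (st s τ k) (st s τ (k+1))
      = ∑ τ : Traj S A k, trajP π P s k τ *
          ∑ b : A, ∑ x : S, π (st s τ k) b * P (st s τ k) b x * f (ac τ 0) (st s τ k) x := by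
  induction N, hN using Nat.le_induction with
  | base =>
    rw [sum_snoc]
    refine Finset.sum_congr rfl fun τ _ => ?_
    simp only [Finset.mul_sum]
    refine Finset.sum_congr rfl fun b _ => Finset.sum_congr rfl fun x _ => ?_
    rw [trajP_snoc, ac_snoc τ b x 0 (by omega), st_snoc s τ b x k le_rfl, st_snoc_last]
    ring
  | succ N hN ih =>
    rw [← ih, sum_snoc]
    refine Finset.sum_congr rfl fun τ _ => ?_
    have : ∀ b x, trajP π P s (N+1) (Fin.snoc τ.1 b, Fin.snoc τ.2 x) *
        f (ac ((Fin.snoc τ.1 b, Fin.snoc τ.2 x) : Traj S A (N+1)) 0)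
          (st s ((Fin.snoc τ.1 b, Fin.snoc τ.2 x) : Traj S A (N+1)) k)
          (st s ((Fin.snoc τ.1 b, Fin.snoc τ.2 x) : Traj S A (N+1)) (k+1))
        = trajP π P s N τ * f (ac τ 0) (st s τ k) (st s τ (k+1)) * π (st s τ N) b
          * P (st s τ N) b x := by
      intro b x
      rw [trajP_snoc, ac_snoc τ b x 0 (by omega), st_snoc s τ b x k (by omega),
        st_snoc s τ b x (k+1) hN]
      ring
    simp only [this, ← Finset.mul_sum, hPsum, hπsum, mul_one]

theorem prE_joint {S A : Type*} [Fintype S] [Fintype A] [Nonempty A]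
    (π : S → A → ℝ) (P : S → A → S → ℝ) (s : S)
    (hπsum : ∀ s₀ : S, ∑ a : A, π s₀ a = 1)
    (hPsum : ∀ (s₀ : S) (a : A), ∑ s' : S, P s₀ a s' = 1)
    (k : ℕ) (hk : 1 ≤ k) (N : ℕ) (hN : k + 1 ≤ N) (E : A → Prop) (s' s'' : S) :
    prE π P s N (fun τ => E (ac τ 0) ∧ st s τ k = s' ∧ st s τ (k + 1) = s'')
      = prE π P s N (fun τ => E (ac τ 0) ∧ st s τ k = s')
        * ∑ b : A, π s' b * P s' b s'' := by
  have h1 := expct_red π P s hπsum hPsum k hk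
    (fun c y z => if E c ∧ y = s' ∧ z = s'' then 1 else 0) N hN
  have h2 := expct_red π P s hπsum hPsum k hk
    (fun c y z => if E c ∧ y = s' then 1 else 0) N hN
  simp only [mul_ite, mul_one, mul_zero] at h1 h2
  have e1 : prE π P s N (fun τ => E (ac τ 0) ∧ st s τ k = s' ∧ st s τ (k + 1) = s'') = _ :=
    Eq.trans (by unfold prE; refine Finset.sum_congr rfl fun τ _ => ?_; congr) h1
  have e2 : prE π P s N (fun τ => E (ac τ 0) ∧ st s τ k = s') = _ :=
    Eq.trans (by unfold prE; refine Finset.sum_congr rfl fun τ _ => ?_; congr) h2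
  rw [e1, e2, Finset.sum_mul]
  refine Finset.sum_congr rfl fun τ _ => ?_
  by_cases h : E (ac τ 0) ∧ st s τ k = s'
  · obtain ⟨hE, hs⟩ := h
    simp [hE, hs, ← Finset.mul_sum, hPsum, hπsum]
  · have h' : ∀ x, ¬ (E (ac τ 0) ∧ st s τ k = s' ∧ x = s'') := fun x hx => h ⟨hx.1, hx.2.1⟩
    simp [h, h']

theorem stmt_4 {S A : Type*} [Fintype S] [Fintype A] [Nonempty S] [Nonempty A]
    (π : S → A → ℝ) (P : S → A → S → ℝ) (r : S → A → ℝ) (γ : ℝ)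
    (N : ℕ) (s : S)
    (hπpos : ∀ s₀ a, 0 < π s₀ a) (hπsum : ∀ s₀ : S, ∑ a : A, π s₀ a = 1)
    (hPnn : ∀ s₀ a s', 0 ≤ P s₀ a s') (hPsum : ∀ (s₀ : S) (a : A), ∑ s' : S, P s₀ a s' = 1)
    (hγ0 : 0 ≤ γ) (hγ1 : γ ≤ 1) (hN : 1 ≤ N)
    (k : ℕ) (hk1 : 1 ≤ k) (hk2 : k ≤ N - 1) (a : A) (s' s'' : S)
    (hpos : 0 < prE π P s N (fun τ => st s τ k = s' ∧ st s τ (k + 1) = s'')) :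
    prE π P s N (fun τ => ac τ 0 = a ∧ st s τ k = s')
        / prE π P s N (fun τ => st s τ k = s')
      = prE π P s N (fun τ => ac τ 0 = a ∧ st s τ k = s' ∧ st s τ (k + 1) = s'')
        / prE π P s N (fun τ => st s τ k = s' ∧ st s τ (k + 1) = s'') := by
  have hN' : k + 1 ≤ N := by omega
  have hA := prE_joint π P s hπsum hPsum k hk1 N hN' (fun c => c = a) s' s''
  have hT := prE_joint π P s hπsum hPsum k hk1 N hN' (fun _ => True) s' s''
  simp only [true_and] at hT
  rw [hT] at hpos
  rw [hA, hT, mul_div_mul_right]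
  intro h0
  rw [h0, mul_zero] at hpos
  exact lt_irrefl _ hpos

end HCA
end
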